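/- arXiv:math/0703305 — 2 statements merged into one kernel-verified Lean document; each statement's English description precedes it below -/
import Mathlib

section
/- For all integers m ≥ 0 and 0 ≤ j ≤ m, the product j! · T_{m-j} divides T_m; in particular the ratio T_m/(j! · T_{m-j}) is a positive integer. (These integers appear as the coefficients T_m/(j!·T_{m-j}) of 𝔰_j·𝔗𝔡_{m-j} in the integral class 𝔠𝔱_m = T_m·(ch·Td)_m.) -/
/-- `T k = ∏_p p^{⌊k/(p-1)⌋}`, the product over all primes `p`; since the exponent
vanishes for `p > k + 1`, it suffices to take the product over primes `p < k + 2`. -/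
def ToddDenom (k : ℕ) : ℕ :=
  ∏ p ∈ (Finset.range (k + 2)).filter Nat.Prime, p ^ (k / (p - 1))

theorem toddDenom_ne_zero_aux (k : ℕ) : ToddDenom k ≠ 0 := by
  unfold ToddDenom
  refine Finset.prod_ne_zero_iff.mpr fun p hp => pow_ne_zero _ ?_
  exact (Finset.mem_filter.mp hp).2.ne_zero

theorem toddDenom_factorization_aux (k p : ℕ) (hp : p.Prime) :
    (ToddDenom k).factorization p = k / (p - 1) := by
  unfold ToddDenom
  rw [Nat.factorization_prod
    (fun q hq => pow_ne_zero _ (Finset.mem_filter.mp hq).2.ne_zero), Finset.sum_apply']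
  have h1 : ∀ q ∈ (Finset.range (k + 2)).filter Nat.Prime,
      (q ^ (k / (q - 1))).factorization p = if p = q then k / (p - 1) else 0 := by
    intro q hq
    rw [(Finset.mem_filter.mp hq).2.factorization_pow, Finsupp.single_apply]
    by_cases h : q = p
    · subst h; simp
    · rw [if_neg h, if_neg (Ne.symm h)]
  rw [Finset.sum_congr rfl h1, Finset.sum_ite_eq]
  split_ifs with h
  · rfl
  · have h2 : ¬ p < k + 2 := fun h3 =>
      h (Finset.mem_filter.mpr ⟨Finset.mem_range.mpr h3, hp⟩)
    exact (Nat.div_eq_of_lt (by omega)).symm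

/-- For `0 ≤ j ≤ m`, the product `j! · T_{m-j}` divides `T_m`; in particular
`T_m/(j!·T_{m-j})` is a positive integer. -/
theorem factorial_mul_toddDenom_dvd (m j : ℕ) (h : j ≤ m) :
    Nat.factorial j * ToddDenom (m - j) ∣ ToddDenom m ∧
      0 < ToddDenom m / (Nat.factorial j * ToddDenom (m - j)) := by
  have hne : Nat.factorial j * ToddDenom (m - j) ≠ 0 :=
    mul_ne_zero (Nat.factorial_ne_zero j) (toddDenom_ne_zero_aux _)
  have hd : Nat.factorial j * ToddDenom (m - j) ∣ ToddDenom m := by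
    rw [← Nat.factorization_prime_le_iff_dvd hne (toddDenom_ne_zero_aux m)]
    intro p hp
    rw [Nat.factorization_mul (Nat.factorial_ne_zero j) (toddDenom_ne_zero_aux _),
      Finsupp.add_apply, toddDenom_factorization_aux _ _ hp, toddDenom_factorization_aux _ _ hp]
    have h1 := Nat.factorization_factorial_le_div_pred hp j
    have h2 := Nat.add_div_le_add_div j (m - j) (p - 1)
    rw [Nat.add_sub_cancel' h] at h2
    omega
  exact ⟨hd, Nat.div_pos (Nat.le_of_dvd (Nat.pos_of_ne_zero (toddDenom_ne_zero_aux m)) hd)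
    (Nat.pos_of_ne_zero hne)⟩
end

section
/- Let m ≥ 0, let l be a nonnegative integer, let N ≥ 0, and let k_1, ..., k_N be nonnegative integers with l + k_1 + ⋯ + k_N = m. Then the rational number T_m · (1/l!) · ∏_{j=1}^N (B'_{k_j} / k_j!) is an integer, where B'_n denotes the n-th Bernoulli number with the convention B'_1 = +1/2. (This says that the polynomial 𝔠𝔱_m = T_m·(ch·Td)_m, the numerator of the degree-m part of the product of the Chern character series with the Todd series, has integral coefficients when expanded in the Chern roots: the coefficient of x'^l · x_1^{k_1}⋯x_N^{k_N} in ch·Td, namely (1/l!)·∏_j B'_{k_j}/k_j!, is cleared by T_m.) -/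
theorem toddDenom_eq (k M : ℕ) (h : k ≤ M) :
    ToddDenom k = ∏ p ∈ (Finset.range (M + 2)).filter Nat.Prime, p ^ (k / (p - 1)) := by
  unfold ToddDenom
  apply Finset.prod_subset
  · intro p hp
    simp only [Finset.mem_filter, Finset.mem_range] at hp ⊢
    exact ⟨by omega, hp.2⟩
  · intro p hp hn
    simp only [Finset.mem_filter, Finset.mem_range] at hp hn
    have : ¬ p < k + 2 := fun h' => hn ⟨h', hp.2⟩
    rw [Nat.div_eq_of_lt (by omega), pow_zero]

theorem toddDenom_mul_dvd (a b : ℕ) : ToddDenom a * ToddDenom b ∣ ToddDenom (a + b) := by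
  rw [toddDenom_eq a (a + b) (by omega), toddDenom_eq b (a + b) (by omega),
    toddDenom_eq (a + b) (a + b) le_rfl, ← Finset.prod_mul_distrib]
  apply Finset.prod_dvd_prod_of_dvd
  intro p _
  rw [← pow_add]
  exact pow_dvd_pow _ (Nat.add_div_le_add_div _ _ _)

theorem factorial_succ_dvd_toddDenom (j : ℕ) : (j + 1).factorial ∣ ToddDenom j := by
  rw [Nat.dvd_iff_prime_pow_dvd_dvd]
  intro p k hp hk
  rcases Nat.eq_zero_or_pos k with rfl | hk0
  · simp
  have hple : p ≤ j + 1 := (hp.dvd_factorial).1 ((dvd_pow_self p hk0.ne').trans hk)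
  haveI : Fact p.Prime := ⟨hp⟩
  have h1 := (padicValNat_dvd_iff_le (p := p) (Nat.factorial_ne_zero (j + 1))).1 hk
  have h2 := sub_one_mul_padicValNat_factorial (p := p) (j + 1)
  have h3 : 0 < (p.digits (j + 1)).sum := by
    by_contra h0
    have h0' : (p.digits (j + 1)).sum = 0 := by omega
    rw [List.sum_eq_zero_iff] at h0'
    have h4 : p.digits (j + 1) ≠ [] := Nat.digits_ne_nil_iff_ne_zero.2 (by omega)
    exact Nat.getLast_digit_ne_zero p (m := j + 1) (by omega) (h0' _ (List.getLast_mem h4))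
  have hp2 := hp.two_le
  have h5 : k ≤ j / (p - 1) := by
    rw [Nat.le_div_iff_mul_le (by omega)]
    calc k * (p - 1) ≤ padicValNat p (j + 1).factorial * (p - 1) := Nat.mul_le_mul_right _ h1
      _ ≤ j := by rw [mul_comm, h2]; omega
  refine (pow_dvd_pow p h5).trans ?_
  unfold ToddDenom
  exact Finset.dvd_prod_of_mem (fun p => p ^ (j / (p - 1)))
    (by simp only [Finset.mem_filter, Finset.mem_range]; exact ⟨by omega, hp⟩)

def ToddInt (n : ℕ) (x : ℚ) : Prop := ∃ z : ℤ, (ToddDenom n : ℚ) * x = z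

theorem ToddInt.mul {a b : ℕ} {x y : ℚ} (hx : ToddInt a x) (hy : ToddInt b y) :
    ToddInt (a + b) (x * y) := by
  obtain ⟨u, hu⟩ := hx
  obtain ⟨v, hv⟩ := hy
  obtain ⟨c, hc⟩ := toddDenom_mul_dvd a b
  refine ⟨u * v * c, ?_⟩
  rw [hc]
  push_cast
  rw [← hu, ← hv]
  ring

theorem ToddInt.sub {a : ℕ} {x y : ℚ} (hx : ToddInt a x) (hy : ToddInt a y) :
    ToddInt a (x - y) := by
  obtain ⟨u, hu⟩ := hx
  obtain ⟨v, hv⟩ := hy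
  exact ⟨u - v, by push_cast; rw [← hu, ← hv]; ring⟩

theorem ToddInt.sum {a : ℕ} {ι : Type*} (s : Finset ι) (f : ι → ℚ)
    (h : ∀ i ∈ s, ToddInt a (f i)) : ToddInt a (∑ i ∈ s, f i) := by
  classical
  induction s using Finset.induction_on with
  | empty => exact ⟨0, by simp⟩
  | insert i s hi ih =>
    obtain ⟨u, hu⟩ := h i (Finset.mem_insert_self _ _)
    obtain ⟨v, hv⟩ := ih (fun j hj => h j (Finset.mem_insert_of_mem hj))
    exact ⟨u + v, by rw [Finset.sum_insert hi]; push_cast; rw [← hu, ← hv]; ring⟩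

theorem toddInt_of_dvd {a d : ℕ} (hd : d ≠ 0) (h : d ∣ ToddDenom a) :
    ToddInt a (1 / (d : ℚ)) := by
  obtain ⟨c, hc⟩ := h
  have : (d : ℚ) ≠ 0 := by exact_mod_cast hd
  exact ⟨c, by rw [hc]; push_cast; field_simp⟩

theorem toddInt_inv_factorial (l : ℕ) : ToddInt l (1 / (l.factorial : ℚ)) :=
  toddInt_of_dvd (Nat.factorial_ne_zero _)
    ((Nat.factorial_dvd_factorial (Nat.le_succ l)).trans (factorial_succ_dvd_toddDenom l))

theorem toddInt_bernoulli (n : ℕ) : ToddInt n (bernoulli' n / (n.factorial : ℚ)) := by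
  induction n using Nat.strong_induction_on with
  | _ n ih =>
    have key : bernoulli' n / (n.factorial : ℚ) = 1 / (n.factorial : ℚ) -
        ∑ k ∈ Finset.range n, bernoulli' k / (k.factorial : ℚ) *
          (1 / ((n - k + 1).factorial : ℚ)) := by
      rw [bernoulli'_def, sub_div, Finset.sum_div]
      congr 1
      apply Finset.sum_congr rfl
      intro k hk
      have hk' : k ≤ n := (Finset.mem_range.1 hk).le
      rw [Nat.cast_choose ℚ hk', Nat.factorial_succ]
      push_cast [Nat.cast_sub hk']
      have h1 : (n.factorial : ℚ) ≠ 0 := by exact_mod_cast Nat.factorial_ne_zero _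
      have h2 : (k.factorial : ℚ) ≠ 0 := by exact_mod_cast Nat.factorial_ne_zero _
      have h3 : ((n - k).factorial : ℚ) ≠ 0 := by exact_mod_cast Nat.factorial_ne_zero _
      have h4 : (n : ℚ) - k + 1 ≠ 0 := by
        rw [← Nat.cast_sub hk']; positivity
      field_simp
    rw [key]
    refine (toddInt_inv_factorial n).sub (ToddInt.sum _ _ fun k hk => ?_)
    have hk' := Finset.mem_range.1 hk
    have := (ih k hk').mul (toddInt_of_dvd (Nat.factorial_ne_zero _)
      (factorial_succ_dvd_toddDenom (n - k)))
    rwa [Nat.add_sub_cancel' hk'.le] at this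

theorem toddInt_prod {ι : Type*} (s : Finset ι) (k : ι → ℕ) :
    ToddInt (∑ j ∈ s, k j) (∏ j ∈ s, bernoulli' (k j) / (Nat.factorial (k j) : ℚ)) := by
  classical
  induction s using Finset.induction_on with
  | empty => exact ⟨ToddDenom 0, by simp⟩
  | insert i s hi ih =>
    rw [Finset.sum_insert hi, Finset.prod_insert hi]
    exact (toddInt_bernoulli _).mul ih

/-- If `l + k_1 + ⋯ + k_N = m`, then `T_m · (1/l!) · ∏_j (B'_{k_j}/k_j!)` is an integer,
where `B'` are the Bernoulli numbers with the convention `B'_1 = +1/2`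
(Mathlib's `bernoulli'`).  That is, the numerator `𝔠𝔱_m = T_m·(ch·Td)_m` has integral
coefficients when expanded in the Chern roots. -/
theorem toddDenom_mul_chTd_coeff_isInt (m l N : ℕ) (k : Fin N → ℕ)
    (hsum : l + ∑ j, k j = m) :
    ∃ z : ℤ, (ToddDenom m : ℚ) * (1 / (Nat.factorial l : ℚ)) *
      ∏ j, bernoulli' (k j) / (Nat.factorial (k j) : ℚ) = z := by
  subst hsum
  rw [mul_assoc]
  exact (toddInt_inv_factorial l).mul (toddInt_prod Finset.univ k)
end
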